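/- Let D be a dyadic grid in ℝ^d, let w be a weight with [w]_FW < ∞, let η ∈ (0,1], let S ⊆ D be a finite η-sparse collection, let a = {a_Q}_{Q∈S} be positive reals, and let q, r ∈ (0,∞] with q < r. Then there exist δ > 0, depending only on d, q and r, and a constant c, depending only on d, q and r, such that for all λ, γ > 0: w( { x : A^q_S(a)(x) > 2λ and A^r_S(a)(x) ≤ γ^{1/q − 1/r} λ } ) ≤ c · exp( −δη/(γ[w]_FW) ) · w( { x : A^q_S(a)(x) > λ } ). -/

import Mathlib

open MeasureTheory ENNReal Set

noncomputable section

namespace Paper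

variable {d m : ℕ}

abbrev Rd (d : ℕ) := Fin d → ℝ

structure Cube (d : ℕ) where
  corner : Rd d
  side : ℝ
  side_pos : 0 < side

def Cube.set (Q : Cube d) : Set (Rd d) :=
  {x | ∀ i, Q.corner i ≤ x i ∧ x i < Q.corner i + Q.side}

/-- the average `⟨f⟩_{q,Q}` for finite exponent `q`, of an `ℝ≥0∞`-valued function -/
def eAvg (f : Rd d → ℝ≥0∞) (q : ℝ) (Q : Cube d) : ℝ≥0∞ :=
  ((volume Q.set)⁻¹ * ∫⁻ x in Q.set, f x ^ q) ^ (1 / q)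

def ofFn (f : Rd d → ℝ) : Rd d → ℝ≥0∞ := fun x => ENNReal.ofReal |f x|

/-- the average `⟨f⟩_{q,Q}` for finite exponent `q > 0` -/
def avg (f : Rd d → ℝ) (q : ℝ) (Q : Cube d) : ℝ≥0∞ := eAvg (ofFn f) q Q

/-- the average `⟨f⟩_{q,Q}` for exponent `q ∈ (0,∞]` -/
def avgE (f : Rd d → ℝ) (q : ℝ≥0∞) (Q : Cube d) : ℝ≥0∞ :=
  if q = ∞ then essSup (ofFn f) (volume.restrict Q.set) else avg f q.toReal Q

def IsWeight (u : Rd d → ℝ) : Prop :=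
  MeasureTheory.LocallyIntegrable u volume ∧ ∀ᵐ x ∂(volume : Measure (Rd d)), 0 < u x

/-- `u(A) = ∫_A u dx` -/
def wMeas (u : Rd d → ℝ) (A : Set (Rd d)) : ℝ≥0∞ := ∫⁻ x in A, ENNReal.ofReal (u x)

/-- the Hardy–Littlewood maximal operator -/
def maximal (f : Rd d → ℝ) (x : Rd d) : ℝ≥0∞ :=
  ⨆ (Q : Cube d) (_ : x ∈ Q.set), avg f 1 Q

/-- the Fujii–Wilson constant `[u]_FW` -/
def FW (u : Rd d → ℝ) : ℝ≥0∞ :=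
  ⨆ Q : Cube d, (wMeas u Q.set)⁻¹ * ∫⁻ x in Q.set, maximal (Q.set.indicator u) x

/-- Hölder conjugate in `ℝ≥0∞` -/
def conj (q : ℝ≥0∞) : ℝ≥0∞ := (1 - q⁻¹)⁻¹

def prodW (w : Fin m → Rd d → ℝ) : Rd d → ℝ := fun x => ∏ j, w j x

/-- the two-weight multilinear Muckenhoupt constant `[w⃗,ω]_{p⃗}`; here `p0` is the
real number with `1/p0 = ∑ 1/p j`. -/
def APtw (p0 : ℝ) (p : Fin m → ℝ≥0∞) (w : Fin m → Rd d → ℝ) (ω : Rd d → ℝ) : ℝ≥0∞ :=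
  ⨆ Q : Cube d, avg ω p0 Q * ∏ j, avgE (fun x => (w j x)⁻¹) (conj (p j)) Q

/-- the multilinear Muckenhoupt constant `[w⃗]_{p⃗}` -/
def AP (p0 : ℝ) (p : Fin m → ℝ≥0∞) (w : Fin m → Rd d → ℝ) : ℝ≥0∞ :=
  APtw p0 p w (prodW w)

def IsSparse (η : ℝ) (S : Set (Cube d)) : Prop :=
  ∃ E : Cube d → Set (Rd d),
    (∀ Q ∈ S, E Q ⊆ Q.set ∧ MeasurableSet (E Q) ∧
      ENNReal.ofReal η * volume Q.set ≤ volume (E Q)) ∧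
    S.PairwiseDisjoint E

def dyadicGrid (d : ℕ) (α : Rd d) : Set (Cube d) :=
  {Q | ∃ (j : ℤ) (k : Fin d → ℤ),
    Q.side = (2:ℝ) ^ (-j) ∧ ∀ i, Q.corner i = (2:ℝ) ^ (-j) * (α i + k i)}

def IsDyadicGrid (D : Set (Cube d)) : Prop :=
  ∃ α : Rd d, (∀ i, α i = 0 ∨ α i = 1/3 ∨ α i = 2/3) ∧ D = dyadicGrid d α

/-- bounded, compactly supported, measurable -/
def BCS (f : Rd d → ℝ) : Prop :=
  Measurable f ∧ (∃ C, ∀ x, |f x| ≤ C) ∧ HasCompactSupport f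

def sparseForm (S : Set (Cube d)) (f : Fin m → Rd d → ℝ) (g : Rd d → ℝ) : ℝ≥0∞ :=
  ∑' Q : S, (∏ j, avg (f j) 1 Q.1) * avg g 1 Q.1 * volume (Q.1).set

def SparseFormDom (T : (Fin m → Rd d → ℝ) → Rd d → ℝ) (CT : ℝ≥0∞) : Prop :=
  ∀ (f : Fin m → Rd d → ℝ) (g : Rd d → ℝ), (∀ j, BCS (f j)) → BCS g →
    ∃ S : Set (Cube d), IsSparse (1/2) S ∧
      (∫⁻ x, ofFn (T f) x * ofFn g x) ≤ CT * sparseForm S f g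

/-- `‖f‖_{L^{p,∞}_u} = sup_{λ>0} λ (u^p({f > λ}))^{1/p}` for `ℝ≥0∞`-valued `f` -/
def eWeakNorm (u : Rd d → ℝ) (p : ℝ) (f : Rd d → ℝ≥0∞) : ℝ≥0∞ :=
  ⨆ (l : ℝ) (_ : 0 < l), ENNReal.ofReal l *
    (∫⁻ x in {x | ENNReal.ofReal l < f x}, ENNReal.ofReal (u x) ^ p) ^ (1/p)

def weakNorm (u : Rd d → ℝ) (p : ℝ) (f : Rd d → ℝ) : ℝ≥0∞ := eWeakNorm u p (ofFn f)

/-- `‖f‖_{L^p_u} = ‖fu‖_{L^p}` -/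
def LpW (u : Rd d → ℝ) (p : ℝ≥0∞) (f : Rd d → ℝ) : ℝ≥0∞ :=
  eLpNorm (fun x => f x * u x) p volume

/-- `A^r_S(a)(x) = (Σ_{Q∈S, Q∋x} a_Q^r)^{1/r}`, with the supremum when `r = ∞`. -/
def AFam (S : Set (Cube d)) (a : Cube d → ℝ) (r : ℝ≥0∞) (x : Rd d) : ℝ≥0∞ :=
  if r = ∞ then ⨆ (Q : S) (_ : x ∈ (Q.1).set), ENNReal.ofReal (a Q.1)
  else (∑' Q : S,
      (Q.1).set.indicator (fun _ => ENNReal.ofReal (a Q.1) ^ r.toReal) x) ^ (1 / r.toReal)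

section Filtration

/-- `U` is a union of fibers of `g`. -/
def FiberSaturated {X ι : Type*} (g : X → ι) (U : Set X) : Prop :=
  ∀ x y, g x = g y → x ∈ U → y ∈ U

/-- The fiber of `g` through `x`. -/
def fiberOf {X ι : Type*} (g : X → ι) (x : X) : Set X := g ⁻¹' {g x}

lemma mem_fiberOf_self {X ι : Type*} (g : X → ι) (x : X) : x ∈ fiberOf g x := rfl

lemma fiberOf_eq {X ι : Type*} {g : X → ι} {x y : X} (h : y ∈ fiberOf g x) :
    fiberOf g y = fiberOf g x := by
  have : g y = g x := h
  simp [fiberOf, this]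

lemma measurableSet_fiberOf {X ι : Type*} [MeasurableSpace X] [MeasurableSpace ι]
    [MeasurableSingletonClass ι] {g : X → ι} (hg : Measurable g) (x : X) :
    MeasurableSet (fiberOf g x) := hg (measurableSet_singleton _)

variable {X ι : Type*} [MeasurableSpace X] [MeasurableSpace ι] [Countable ι]
  [MeasurableSingletonClass ι]

lemma FiberSaturated.measurableSet {g : X → ι} (hg : Measurable g) {U : Set X}
    (hU : FiberSaturated g U) : MeasurableSet U := by
  have : U = g ⁻¹' (g '' U) := by
    refine (subset_preimage_image g U).antisymm ?_
    rintro y ⟨x, hx, hxy⟩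
    exact hU x y hxy hx
  rw [this]
  exact hg (Set.to_countable _).measurableSet

lemma FiberSaturated.measure_le {g : X → ι} (hg : Measurable g) {U : Set X}
    (hU : FiberSaturated g U) {μ ν : Measure X}
    (h : ∀ x ∈ U, μ (fiberOf g x) ≤ ν (fiberOf g x)) : μ U ≤ ν U := by
  have hUeq : U = ⋃ i ∈ g '' U, g ⁻¹' {i} := by
    ext y
    simp only [mem_iUnion, mem_preimage, mem_singleton_iff, exists_prop, exists_eq_right']
    exact ⟨fun hy => ⟨y, hy, rfl⟩, fun ⟨x, hx, hxy⟩ => hU x y hxy hx⟩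
  have key : ∀ ρ : Measure X, ρ U = ∑' i : g '' U, ρ (g ⁻¹' {(i : ι)}) := by
    intro ρ
    conv_lhs => rw [hUeq]
    refine measure_biUnion (Set.to_countable _) ?_ fun i _ => hg (measurableSet_singleton _)
    intro i _ j _ hij
    exact Disjoint.preimage g (by simpa using hij)
  rw [key μ, key ν]
  refine ENNReal.tsum_le_tsum ?_
  rintro ⟨_, x, hx, rfl⟩
  exact h x hx

/-- The number of indices `k ∈ [l, B)` with `x ∈ D k`. -/
def levelCount {X : Type*} (D : ℕ → Set X) (B l : ℕ) (x : X) : ℕ :=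
  ∑ k ∈ Finset.Ico l B, (D k).indicator 1 x

lemma measurable_levelCount {D : ℕ → Set X} (hD : ∀ k, MeasurableSet (D k)) (B l : ℕ) :
    Measurable (levelCount D B l) :=
  Finset.measurable_sum _ fun k _ => measurable_one.indicator (hD k)

lemma levelCount_of_le {X : Type*} (D : ℕ → Set X) {B l : ℕ} (h : B ≤ l) (x : X) :
    levelCount D B l x = 0 := by
  simp [levelCount, Finset.Ico_eq_empty_of_le h]

lemma levelCount_eq_add {X : Type*} (D : ℕ → Set X) {B l : ℕ} (h : l < B) (x : X) :
    levelCount D B l x = (D l).indicator 1 x + levelCount D B (l + 1) x := by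
  rw [levelCount, Finset.sum_eq_sum_Ico_succ_bot h, levelCount]

/-- At most `m` indices `l` with `x ∈ D l` have level count at most `m`. -/
lemma sum_indicator_levelCount_le {X : Type*} (D : ℕ → Set X) (B m j : ℕ) (x : X) :
    ∑ l ∈ Finset.Ico j B, (D l ∩ {y | levelCount D B l y ≤ m}).indicator (1 : X → ℕ) x
      ≤ min m (levelCount D B j x) := by
  rcases le_total B j with hj | hj
  · simp [Finset.Ico_eq_empty_of_le hj]
  induction hj using Nat.decreasingInduction with
  | self => simp
  | of_succ k hk ih =>
    rw [Finset.sum_eq_sum_Ico_succ_bot (by omega), levelCount_eq_add D (by omega)]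
    by_cases hx : x ∈ D k
    · by_cases hm : levelCount D B k x ≤ m
      · have hm' := hm
        rw [levelCount_eq_add D (by omega)] at hm'
        simp only [hx, indicator_of_mem, mem_inter_iff, mem_ofPred_eq, hm, and_self,
          Pi.one_apply] at hm' ⊢
        omega
      · rw [indicator_of_notMem (by simp [hm])]
        omega
    · rw [indicator_of_notMem (by simp [hx])]
      omega

lemma measure_le_two_mul_of_lintegral_levelCount {vol : Measure X} {K : Set X} {N : X → ℕ}
    (hN : Measurable N) (hK : MeasurableSet K) (hfin : vol K ≠ ∞) {Λ : ℝ≥0∞} {m : ℕ}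
    (hm : 0 < m) (hΛ : 2 * Λ ≤ m) (h : ∫⁻ x in K, (N x : ℝ≥0∞) ∂vol ≤ Λ * vol K) :
    vol K ≤ 2 * vol (K ∩ {x | N x ≤ m}) := by
  have hms : MeasurableSet {x | N x ≤ m} := hN (measurableSet_Iic)
  have hsplit : vol K = vol (K ∩ {x | N x ≤ m}) + vol (K \ {x | N x ≤ m}) :=
    (measure_inter_add_sdiff K hms).symm
  set a := vol (K ∩ {x | N x ≤ m})
  set b := vol (K \ {x | N x ≤ m}) with hb
  have h1 : (m : ℝ≥0∞) * b ≤ Λ * vol K := by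
    refine le_trans ?_ h
    calc (m : ℝ≥0∞) * b = ∫⁻ x in K \ {x | N x ≤ m}, (m : ℝ≥0∞) ∂vol := by
          rw [setLIntegral_const]
      _ ≤ ∫⁻ x in K \ {x | N x ≤ m}, (N x : ℝ≥0∞) ∂vol := by
          refine setLIntegral_mono' (hK.diff hms) fun x hx => ?_
          have : ¬ N x ≤ m := hx.2
          exact_mod_cast (not_le.1 this).le
      _ ≤ _ := lintegral_mono_set sdiff_subset
  have hm0 : (m : ℝ≥0∞) ≠ 0 := by exact_mod_cast hm.ne'
  have h2 : (m : ℝ≥0∞) * (2 * b) ≤ m * vol K := by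
    calc (m : ℝ≥0∞) * (2 * b) = 2 * (m * b) := by ring
      _ ≤ 2 * (Λ * vol K) := by gcongr
      _ = 2 * Λ * vol K := by ring
      _ ≤ m * vol K := by gcongr
  have h3 : 2 * b ≤ vol K := (ENNReal.mul_le_mul_iff_right hm0 (by simp)).1 h2
  have hbf : b ≠ ∞ := ne_top_of_le_ne_top hfin (measure_mono sdiff_subset)
  have h4 : b ≤ a := by
    rw [hsplit, two_mul] at h3
    exact (ENNReal.add_le_add_iff_right hbf).1 h3
  calc vol K = a + b := hsplit
    _ ≤ a + a := by gcongr
    _ = 2 * a := (two_mul a).symm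

lemma fiberOf_subset_of_le {X ι : Type*} {g : ℕ → X → ι}
    (hg : ∀ n x y, g (n + 1) x = g (n + 1) y → g n x = g n y)
    {j l : ℕ} (h : j ≤ l) (x : X) : fiberOf (g l) x ⊆ fiberOf (g j) x := by
  induction l, h using Nat.le_induction with
  | base => exact subset_rfl
  | succ n hn ih =>
    intro y hy
    exact ih (hg n y x hy)

/-- Packing with respect to `vol` transfers to `μ`, at the price of a maximal function `h`. -/
lemma sum_measure_inter_le_lintegral {g : ℕ → X → ι} (hgm : ∀ n, Measurable (g n))
    (hg : ∀ n x y, g (n + 1) x = g (n + 1) y → g n x = g n y)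
    {vol μ : Measure X} {D : ℕ → Set X} (hD : ∀ k, FiberSaturated (g k) (D k)) {B m : ℕ}
    (hhalf : ∀ l x, vol (fiberOf (g l) x) ≤
      2 * vol (fiberOf (g l) x ∩ {y | levelCount D B l y ≤ m}))
    (j : ℕ) (x₀ : X) {h : X → ℝ≥0∞} (hh : Measurable h)
    (hμ : ∀ l x, j ≤ l → x ∈ fiberOf (g j) x₀ →
      ∃ c, μ (fiberOf (g l) x) ≤ c * vol (fiberOf (g l) x) ∧ ∀ y ∈ fiberOf (g l) x, c ≤ h y) :
    ∑ l ∈ Finset.Ico j B, μ (fiberOf (g j) x₀ ∩ D l) ≤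
      2 * m * ∫⁻ x in fiberOf (g j) x₀, h x ∂vol := by
  have hDm : ∀ k, MeasurableSet (D k) := fun k => (hD k).measurableSet (hgm k)
  have hK := measurableSet_fiberOf (hgm j) x₀
  set K := fiberOf (g j) x₀ with hKdef
  have hNm : ∀ l, MeasurableSet {y | levelCount D B l y ≤ m} := fun l =>
    measurable_levelCount hDm B l measurableSet_Iic
  have h1 : ∀ l ∈ Finset.Ico j B, μ (K ∩ D l) ≤
      2 * ∫⁻ x in K, h x * (D l ∩ {y | levelCount D B l y ≤ m}).indicator 1 x ∂vol := by
    intro l hl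
    have hjl : j ≤ l := (Finset.mem_Ico.1 hl).1
    have hsat : FiberSaturated (g l) (K ∩ D l) := by
      rintro x y hxy ⟨hx, hx'⟩
      refine ⟨?_, hD l x y hxy hx'⟩
      rw [hKdef, ← fiberOf_eq hx]
      exact fiberOf_subset_of_le hg hjl x hxy.symm
    have hKD : MeasurableSet (K ∩ D l) := hK.inter (hDm l)
    have := hsat.measure_le (hgm l) (μ := μ)
      (ν := (2 : ℝ≥0∞) • (vol.restrict {y | levelCount D B l y ≤ m}).withDensity h) ?_
    · refine this.trans (le_of_eq ?_)
      rw [Measure.smul_apply, withDensity_apply _ hKD, smul_eq_mul, Measure.restrict_restrict hKD]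
      congr 1
      rw [inter_assoc, inter_comm, ← Measure.restrict_restrict ((hDm l).inter (hNm l)),
        ← lintegral_indicator ((hDm l).inter (hNm l))]
      refine lintegral_congr fun x => ?_
      by_cases hx : x ∈ D l ∩ {y | levelCount D B l y ≤ m} <;> simp [hx]
    · intro x hx
      have hf := measurableSet_fiberOf (hgm l) x
      rw [Measure.smul_apply, withDensity_apply _ hf, smul_eq_mul, Measure.restrict_restrict hf]
      obtain ⟨c, hc, hch⟩ := hμ l x hjl hx.1
      calc μ (fiberOf (g l) x) ≤ c * vol (fiberOf (g l) x) := hc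
        _ ≤ c * (2 * vol (fiberOf (g l) x ∩ {y | levelCount D B l y ≤ m})) := by
          gcongr; exact hhalf l x
        _ = 2 * ∫⁻ y in fiberOf (g l) x ∩ {y | levelCount D B l y ≤ m}, c ∂vol := by
          rw [setLIntegral_const]; ring
        _ ≤ _ := by
          gcongr 2 * ?_
          exact setLIntegral_mono' (hf.inter (hNm l)) fun y hy => hch y hy.1
  calc ∑ l ∈ Finset.Ico j B, μ (K ∩ D l)
      ≤ ∑ l ∈ Finset.Ico j B, 2 * ∫⁻ x in K, h x *
          (D l ∩ {y | levelCount D B l y ≤ m}).indicator 1 x ∂vol := Finset.sum_le_sum h1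
    _ = 2 * ∫⁻ x in K, h x * ((∑ l ∈ Finset.Ico j B,
          (D l ∩ {y | levelCount D B l y ≤ m}).indicator (1 : X → ℕ) x : ℕ) : ℝ≥0∞) ∂vol := by
        rw [← Finset.mul_sum, ← lintegral_finsetSum]
        · congr 1
          refine lintegral_congr fun x => ?_
          rw [← Finset.mul_sum]
          push_cast
          congr 1
          refine Finset.sum_congr rfl fun l _ => ?_
          by_cases hx : x ∈ D l ∩ {y | levelCount D B l y ≤ m} <;> simp [hx]
        · exact fun l _ => hh.mul (measurable_one.indicator ((hDm l).inter (hNm l)))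
    _ ≤ 2 * ∫⁻ x in K, h x * (m : ℝ≥0∞) ∂vol := by
        gcongr with x
        exact (sum_indicator_levelCount_le D B m j x).trans (min_le_left _ _)
    _ = 2 * m * ∫⁻ x in K, h x ∂vol := by
        rw [lintegral_mul_const _ hh]; ring

/-- A Carleson packing condition makes the level count exponentially integrable. -/
lemma lintegral_pow_levelCount_le {g : ℕ → X → ι} (hgm : ∀ n, Measurable (g n))
    (hg : ∀ n x y, g (n + 1) x = g (n + 1) y → g n x = g n y)
    {μ : Measure X} {D : ℕ → Set X} (hD : ∀ k, FiberSaturated (g k) (D k)) {B : ℕ}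
    {s Λ : ℝ≥0∞} (hs : 2 * (s * Λ) ≤ 1)
    (hΛ : ∀ j x, ∑ l ∈ Finset.Ico j B, μ (fiberOf (g j) x ∩ D l) ≤ Λ * μ (fiberOf (g j) x))
    (j : ℕ) (x₀ : X) :
    ∫⁻ x in fiberOf (g j) x₀, (1 + s) ^ levelCount D B j x ∂μ ≤ 2 * μ (fiberOf (g j) x₀) := by
  have hDm : ∀ k, MeasurableSet (D k) := fun k => (hD k).measurableSet (hgm k)
  have hpm : ∀ k, Measurable fun x => (1 + s) ^ levelCount D B k x := fun k =>
    (measurable_of_countable fun n : ℕ => (1 + s) ^ n).comp (measurable_levelCount hDm B k)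
  have hexp : ∀ k, k ≤ B → ∀ x, (1 + s) ^ levelCount D B k x =
      1 + ∑ l ∈ Finset.Ico k B, (D l).indicator (fun x => s * (1 + s) ^ levelCount D B (l + 1) x)
        x := by
    intro k hk x
    induction hk using Nat.decreasingInduction with
    | self => simp [levelCount]
    | of_succ k hk ih =>
      rw [Finset.sum_eq_sum_Ico_succ_bot hk, levelCount_eq_add D hk, pow_add, add_left_comm, ← ih]
      by_cases hx : x ∈ D k
      · simp only [hx, indicator_of_mem, Pi.one_apply, pow_one]
        ring
      · simp [hx]
  have htwo : (1 : ℝ≥0∞) + 1 = 2 := one_add_one_eq_two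
  have hbig : ∀ k, B ≤ k → ∀ x₀, ∫⁻ x in fiberOf (g k) x₀, (1 + s) ^ levelCount D B k x ∂μ ≤
      2 * μ (fiberOf (g k) x₀) := by
    intro k hk x₀
    simp only [levelCount_of_le D hk, pow_zero, setLIntegral_const, one_mul]
    rw [← htwo, add_mul, one_mul]
    exact le_self_add
  suffices H : ∀ n k, B ≤ k + n → ∀ x₀, ∫⁻ x in fiberOf (g k) x₀, (1 + s) ^ levelCount D B k x ∂μ
      ≤ 2 * μ (fiberOf (g k) x₀) from H B j (by omega) x₀
  intro n
  induction n with
  | zero => exact fun k hk => hbig k hk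
  | succ n ih =>
    intro k hk x₀
    rcases le_total B k with hBk | hkB
    · exact hbig k hBk x₀
    set K := fiberOf (g k) x₀ with hKdef
    have hK : MeasurableSet K := measurableSet_fiberOf (hgm k) x₀
    have hstep : ∀ l ∈ Finset.Ico k B,
        ∫⁻ x in K ∩ D l, (1 + s) ^ levelCount D B (l + 1) x ∂μ ≤ 2 * μ (K ∩ D l) := by
      intro l hl
      have hkl : k ≤ l := (Finset.mem_Ico.1 hl).1
      have hsat : FiberSaturated (g (l + 1)) (K ∩ D l) := by
        rintro x y hxy ⟨hx, hx'⟩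
        have hxy' := hg l x y hxy
        refine ⟨?_, hD l x y hxy' hx'⟩
        rw [hKdef, ← fiberOf_eq hx]
        exact fiberOf_subset_of_le hg hkl x hxy'.symm
      have := hsat.measure_le (hgm (l + 1))
        (μ := μ.withDensity fun x => (1 + s) ^ levelCount D B (l + 1) x)
        (ν := (2 : ℝ≥0∞) • μ) ?_
      · rwa [withDensity_apply _ (hK.inter (hDm l)), Measure.smul_apply, smul_eq_mul] at this
      · intro x _
        rw [withDensity_apply _ (measurableSet_fiberOf (hgm _) x), Measure.smul_apply, smul_eq_mul]
        exact ih (l + 1) (by omega) x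
    calc ∫⁻ x in K, (1 + s) ^ levelCount D B k x ∂μ
        = ∫⁻ x in K, (1 + ∑ l ∈ Finset.Ico k B,
            (D l).indicator (fun x => s * (1 + s) ^ levelCount D B (l + 1) x) x) ∂μ :=
          lintegral_congr fun x => hexp k hkB x
      _ = μ K + ∑ l ∈ Finset.Ico k B,
            s * ∫⁻ x in K ∩ D l, (1 + s) ^ levelCount D B (l + 1) x ∂μ := by
          rw [lintegral_add_left measurable_const, setLIntegral_const, one_mul,
            lintegral_finsetSum]
          · congr 1
            refine Finset.sum_congr rfl fun l _ => ?_
            rw [lintegral_indicator (hDm l), Measure.restrict_restrict (hDm l), inter_comm,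
              lintegral_const_mul _ (hpm _)]
          · exact fun l _ => ((hpm _).const_mul s).indicator (hDm l)
      _ ≤ μ K + ∑ l ∈ Finset.Ico k B, s * (2 * μ (K ∩ D l)) := by
          gcongr with l hl
          exact hstep l hl
      _ = μ K + 2 * s * ∑ l ∈ Finset.Ico k B, μ (K ∩ D l) := by
          rw [Finset.mul_sum]
          congr 1
          exact Finset.sum_congr rfl fun l _ => by ring
      _ ≤ μ K + 2 * s * (Λ * μ K) := by
          gcongr
          exact hΛ k x₀
      _ = μ K + 2 * (s * Λ) * μ K := by ring
      _ ≤ μ K + 1 * μ K := by gcongr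
      _ = 2 * μ K := by rw [one_mul, two_mul]

/-- Stopping-time form of a good-`λ` inequality: `A` is controlled on the first fiber that
enters the saturated sets `V k`. -/
lemma measure_le_mul_measure_iUnion {g : ℕ → X → ι} (hgm : ∀ n, Measurable (g n))
    (hg : ∀ n x y, g (n + 1) x = g (n + 1) y → g n x = g n y)
    {μ : Measure X} {V : ℕ → Set X} (hV : ∀ k, FiberSaturated (g k) (V k))
    {A : Set X} (hA : A ⊆ ⋃ k, V k) {G : ℕ → Set X}
    {ε : ℝ≥0∞} (hε : ∀ k x, μ (fiberOf (g k) x ∩ G k) ≤ ε * μ (fiberOf (g k) x))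
    (hAG : ∀ k, ∀ x ∈ A, x ∈ V k → (∀ i < k, x ∉ V i) → x ∈ G k) :
    μ A ≤ ε * μ (⋃ k, V k) := by
  have hmono : ∀ {j l}, j ≤ l → ∀ x y, g l x = g l y → g j x = g j y := fun h x y hxy =>
    fiberOf_subset_of_le hg h y hxy
  set W : ℕ → Set X := fun k => {x | x ∈ V k ∧ ∀ i < k, x ∉ V i}
  have hWsat : ∀ k, FiberSaturated (g k) (W k) := by
    rintro k x y hxy ⟨hx, hx'⟩
    exact ⟨hV k x y hxy hx, fun i hi hy => hx' i hi (hV i y x (hmono hi.le x y hxy).symm hy)⟩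
  have hWm : ∀ k, MeasurableSet (W k) := fun k => (hWsat k).measurableSet (hgm k)
  have hUW : ⋃ k, V k = ⋃ k, W k := by
    classical
    refine subset_antisymm (fun x hx => ?_) (iUnion_mono fun k x hx => hx.1)
    have hx' : ∃ k, x ∈ V k := mem_iUnion.1 hx
    exact mem_iUnion.2 ⟨Nat.find hx', Nat.find_spec hx', fun i hi => Nat.find_min hx' hi⟩
  have hdisj : Pairwise (Function.onFun Disjoint W) := by
    intro i j hij
    refine Set.disjoint_left.2 fun x hxi hxj => ?_
    rcases lt_or_gt_of_ne hij with h | h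
    · exact hxj.2 i h hxi.1
    · exact hxi.2 j h hxj.1
  have hW : ∀ k, μ (W k ∩ G k) ≤ ε * μ (W k) := by
    intro k
    have := (hWsat k).measure_le (hgm k) (μ := μ.restrict (G k)) (ν := ε • μ) ?_
    · rwa [Measure.restrict_apply (hWm k), Measure.smul_apply, smul_eq_mul] at this
    · intro x _
      rw [Measure.restrict_apply (measurableSet_fiberOf (hgm k) x), Measure.smul_apply,
        smul_eq_mul]
      exact hε k x
  have hAsub : A ⊆ ⋃ k, W k ∩ G k := by
    intro x hx
    obtain ⟨k, hk⟩ := mem_iUnion.1 (hUW ▸ hA hx)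
    exact mem_iUnion.2 ⟨k, hk, hAG k x hx hk.1 hk.2⟩
  calc μ A ≤ μ (⋃ k, W k ∩ G k) := measure_mono hAsub
    _ ≤ ∑' k, μ (W k ∩ G k) := measure_iUnion_le _
    _ ≤ ∑' k, ε * μ (W k) := ENNReal.tsum_le_tsum hW
    _ = ε * μ (⋃ k, V k) := by
        rw [ENNReal.tsum_mul_left, hUW, measure_iUnion hdisj hWm]

end Filtration

section Grid

lemma Cube.set_eq_pi (Q : Cube d) :
    Q.set = Set.pi univ fun i => Ico (Q.corner i) (Q.corner i + Q.side) := by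
  ext x; simp [Cube.set]

lemma Cube.measurableSet_set (Q : Cube d) : MeasurableSet Q.set := by
  rw [Q.set_eq_pi]
  exact MeasurableSet.univ_pi fun _ => measurableSet_Ico

lemma Cube.volume_set (Q : Cube d) : volume Q.set = ENNReal.ofReal Q.side ^ d := by
  rw [Q.set_eq_pi, Real.volume_pi_Ico]
  simp

lemma Cube.volume_set_ne_zero (Q : Cube d) : volume Q.set ≠ 0 := by
  rw [Q.volume_set]
  exact pow_ne_zero _ (by simpa using Q.side_pos)

lemma Cube.volume_set_ne_top (Q : Cube d) : volume Q.set ≠ ∞ := by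
  rw [Q.volume_set]
  exact ENNReal.pow_ne_top ofReal_ne_top

/-- The index of the cell of side `1 / (ρ 2^n)` of the standard grid that contains `x`. -/
def gridIdx (ρ : ℝ) (n : ℕ) (x : Rd d) : Fin d → ℤ := fun i => ⌊ρ * 2 ^ n * x i⌋

lemma measurable_gridIdx (ρ : ℝ) (n : ℕ) : Measurable (gridIdx (d := d) ρ n) :=
  measurable_pi_lambda _ fun i => Int.measurable_floor.comp ((measurable_pi_apply i).const_mul _)

lemma gridIdx_of_succ (ρ : ℝ) (n : ℕ) (x y : Rd d)
    (h : gridIdx ρ (n + 1) x = gridIdx ρ (n + 1) y) : gridIdx ρ n x = gridIdx ρ n y := by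
  have key : ∀ t : ℝ, ⌊t⌋ = ⌊2 * t⌋ / 2 := by
    intro t
    have h1 := Int.floor_le t
    have h2 := Int.lt_floor_add_one t
    have h3 : 2 * ⌊t⌋ ≤ ⌊2 * t⌋ := Int.le_floor.2 (by push_cast; linarith)
    have h4 : ⌊2 * t⌋ < 2 * ⌊t⌋ + 2 := Int.floor_lt.2 (by push_cast; linarith)
    omega
  funext i
  have hi := congrFun h i
  simp only [gridIdx] at hi ⊢
  rw [key (ρ * 2 ^ n * x i), key (ρ * 2 ^ n * y i)]
  rw [show 2 * (ρ * 2 ^ n * x i) = ρ * 2 ^ (n + 1) * x i by ring,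
    show 2 * (ρ * 2 ^ n * y i) = ρ * 2 ^ (n + 1) * y i by ring, hi]

/-- The grid cell of level `n` containing `x`, as a cube. -/
def cellCube {ρ : ℝ} (hρ : 0 < ρ) (n : ℕ) (x : Rd d) : Cube d where
  corner i := gridIdx ρ n x i / (ρ * 2 ^ n)
  side := 1 / (ρ * 2 ^ n)
  side_pos := by positivity

lemma cellCube_set {ρ : ℝ} (hρ : 0 < ρ) (n : ℕ) (x : Rd d) :
    (cellCube hρ n x).set = fiberOf (gridIdx ρ n) x := by
  have hpos : 0 < ρ * 2 ^ n := by positivity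
  ext y
  simp only [Cube.set, cellCube, fiberOf, mem_ofPred_eq, mem_preimage, mem_singleton_iff,
    funext_iff]
  refine forall_congr' fun i => ?_
  rw [← add_div, div_le_iff₀ hpos, lt_div_iff₀ hpos, mul_comm (y i)]
  exact Int.floor_eq_iff.symm

/-- Membership in a cube whose corner is a grid point and whose side is three cells long. -/
lemma Cube.mem_set_iff_gridIdx {ρ : ℝ} (hρ : 0 < ρ) {n : ℕ} {Q : Cube d} {z : Fin d → ℤ}
    (hside : Q.side = 3 / (ρ * 2 ^ n)) (hcorner : ∀ i, Q.corner i = z i / (ρ * 2 ^ n))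
    (x : Rd d) : x ∈ Q.set ↔ ∀ i, z i ≤ gridIdx ρ n x i ∧ gridIdx ρ n x i < z i + 3 := by
  have hpos : 0 < ρ * 2 ^ n := by positivity
  simp only [Cube.set, mem_ofPred_eq]
  refine forall_congr' fun i => ?_
  rw [hside, hcorner, ← add_div, div_le_iff₀ hpos, lt_div_iff₀ hpos, mul_comm (x i)]
  simp only [gridIdx]
  rw [Int.le_floor, Int.floor_lt]
  push_cast
  rfl

/-- A finite family of cubes, each being three cells long in the grid `gridIdx ρ (lev Q)`,
such that cubes of equal level are translates of each other by multiples of the side. -/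
structure IsGridFamily (ρ : ℝ) (S : Finset (Cube d)) (lev : Cube d → ℕ)
    (z : Cube d → Fin d → ℤ) : Prop where
  pos : 0 < ρ
  side_eq : ∀ Q ∈ S, Q.side = 3 / (ρ * 2 ^ lev Q)
  corner_eq : ∀ Q ∈ S, ∀ i, Q.corner i = z Q i / (ρ * 2 ^ lev Q)
  modEq : ∀ Q ∈ S, ∀ Q' ∈ S, ∀ i, z Q i ≡ z Q' i [ZMOD 3]

/-- The union of the cubes of level `k`. -/
def levelSet (S : Finset (Cube d)) (lev : Cube d → ℕ) (k : ℕ) : Set (Rd d) :=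
  {x | ∃ Q ∈ S, lev Q = k ∧ x ∈ Q.set}

variable {ρ : ℝ} {S : Finset (Cube d)} {lev : Cube d → ℕ} {z : Cube d → Fin d → ℤ}

lemma IsGridFamily.mem_set_iff (hS : IsGridFamily ρ S lev z) {Q : Cube d} (hQ : Q ∈ S)
    (x : Rd d) : x ∈ Q.set ↔
      ∀ i, z Q i ≤ gridIdx ρ (lev Q) x i ∧ gridIdx ρ (lev Q) x i < z Q i + 3 :=
  Cube.mem_set_iff_gridIdx hS.pos (hS.side_eq Q hQ) (hS.corner_eq Q hQ) x

lemma IsGridFamily.saturated_set (hS : IsGridFamily ρ S lev z) {Q : Cube d} (hQ : Q ∈ S) :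
    FiberSaturated (gridIdx ρ (lev Q)) Q.set := by
  intro x y hxy hx
  rw [hS.mem_set_iff hQ] at hx ⊢
  rwa [← hxy]

lemma IsGridFamily.saturated_levelSet (hS : IsGridFamily ρ S lev z) (k : ℕ) :
    FiberSaturated (gridIdx ρ k) (levelSet S lev k) := by
  rintro x y hxy ⟨Q, hQ, rfl, hx⟩
  exact ⟨Q, hQ, rfl, hS.saturated_set hQ x y hxy hx⟩

lemma IsGridFamily.eq_of_mem (hS : IsGridFamily ρ S lev z) {Q Q' : Cube d} (hQ : Q ∈ S)
    (hQ' : Q' ∈ S) (hlev : lev Q = lev Q') {x : Rd d} (hx : x ∈ Q.set) (hx' : x ∈ Q'.set) :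
    Q = Q' := by
  rw [hS.mem_set_iff hQ] at hx
  rw [hS.mem_set_iff hQ', ← hlev] at hx'
  have hz : ∀ i, z Q i = z Q' i := by
    intro i
    have h1 := hx i
    have h2 := hx' i
    have h3 := hS.modEq Q hQ Q' hQ' i
    unfold Int.ModEq at h3
    omega
  have hc : Q.corner = Q'.corner := by
    funext i
    rw [hS.corner_eq Q hQ, hS.corner_eq Q' hQ', hz, hlev]
  have hs : Q.side = Q'.side := by rw [hS.side_eq Q hQ, hS.side_eq Q' hQ', hlev]
  cases Q; cases Q'; simp_all

lemma levelCount_levelSet_le {B l : ℕ} (x : Rd d) :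
    (levelCount (levelSet S lev) B l x : ℝ≥0∞) ≤
      ∑ Q ∈ S with l ≤ lev Q, Q.set.indicator 1 x := by
  classical
  have h1 : levelCount (levelSet S lev) B l x ≤
      ∑ Q ∈ S with l ≤ lev Q, Q.set.indicator (1 : Rd d → ℕ) x := by
    have h2 : levelCount (levelSet S lev) B l x =
        ((Finset.Ico l B).filter fun k => x ∈ levelSet S lev k).card := by
      simp [levelCount, indicator_apply]
    have h3 : ∑ Q ∈ S with l ≤ lev Q, Q.set.indicator (1 : Rd d → ℕ) x =
        ((S.filter fun Q => l ≤ lev Q).filter fun Q => x ∈ Q.set).card := by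
      simp [indicator_apply]
    rw [h2, h3]
    refine (Finset.card_le_card ?_).trans (Finset.card_image_le (f := lev))
    intro k hk
    simp only [Finset.mem_filter, Finset.mem_Ico] at hk
    obtain ⟨⟨hlk, _⟩, Q, hQ, rfl, hx⟩ := hk
    simp only [Finset.mem_image, Finset.mem_filter]
    exact ⟨Q, ⟨⟨hQ, hlk⟩, hx⟩, rfl⟩
  calc (levelCount (levelSet S lev) B l x : ℝ≥0∞)
      ≤ ((∑ Q ∈ S with l ≤ lev Q, Q.set.indicator (1 : Rd d → ℕ) x : ℕ) : ℝ≥0∞) := by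
        exact_mod_cast h1
    _ = _ := by
        push_cast
        refine Finset.sum_congr rfl fun Q _ => ?_
        by_cases hx : x ∈ Q.set <;> simp [hx]

lemma IsGridFamily.card_le_levelCount (hS : IsGridFamily ρ S lev z) {B l : ℕ}
    (hB : ∀ Q ∈ S, lev Q < B) (x : Rd d) {T : Finset (Cube d)}
    (hT : ∀ Q ∈ T, Q ∈ S ∧ l ≤ lev Q ∧ x ∈ Q.set) :
    T.card ≤ levelCount (levelSet S lev) B l x := by
  classical
  have h2 : levelCount (levelSet S lev) B l x =
      ((Finset.Ico l B).filter fun k => x ∈ levelSet S lev k).card := by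
    simp [levelCount, indicator_apply]
  rw [h2]
  refine Finset.card_le_card_of_injOn lev ?_ ?_
  · intro Q hQ
    obtain ⟨h1, h2, h3⟩ := hT Q hQ
    simpa using ⟨⟨h2, hB Q h1⟩, Q, h1, rfl, h3⟩
  · intro Q hQ Q' hQ' h
    obtain ⟨h1, -, h3⟩ := hT Q hQ
    obtain ⟨h4, -, h5⟩ := hT Q' hQ'
    exact hS.eq_of_mem h1 h4 h h3 h5

/-- Sparse families satisfy a Carleson packing condition on grid cells. -/
lemma IsGridFamily.lintegral_levelCount_le (hS : IsGridFamily ρ S lev z) {η : ℝ} (hη : 0 < η)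
    (hsp : IsSparse η (S : Set (Cube d))) (B l : ℕ) (x₀ : Rd d) :
    ∫⁻ x in fiberOf (gridIdx ρ l) x₀, (levelCount (levelSet S lev) B l x : ℝ≥0∞) ≤
      (7 ^ d / ENNReal.ofReal η) * volume (fiberOf (gridIdx ρ l) x₀) := by
  classical
  obtain ⟨E, hE, hdisj⟩ := hsp
  have hη0 : ENNReal.ofReal η ≠ 0 := by simpa using hη
  set K := fiberOf (gridIdx ρ l) x₀ with hK
  have hKm : MeasurableSet K := measurableSet_fiberOf (measurable_gridIdx ρ l) x₀
  set C := cellCube hS.pos l x₀ with hC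
  have hCK : C.set = K := cellCube_set hS.pos l x₀
  let P : Cube d := ⟨fun i => C.corner i - 3 * C.side, 7 * C.side, by
    have := C.side_pos; positivity⟩
  set T := S.filter fun Q => l ≤ lev Q ∧ (K ∩ Q.set).Nonempty with hT
  have hsub : ∀ Q ∈ T, Q.set ⊆ P.set := by
    intro Q hQ y hy i
    obtain ⟨hQS, hlQ, x, hxK, hxQ⟩ := Finset.mem_filter.1 hQ
    rw [← hCK] at hxK
    have h1 := hxK i
    have h2 := hxQ i
    have h3 := hy i
    have hside : Q.side ≤ 3 * C.side := by
      rw [hS.side_eq Q hQS, hC, cellCube, mul_one_div]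
      have := hS.pos
      gcongr
      norm_num
    simp only [P]
    constructor <;> linarith
  have hPvol : volume P.set = 7 ^ d * volume K := by
    rw [← hCK, P.volume_set, C.volume_set, ENNReal.ofReal_mul (by norm_num), mul_pow]
    norm_num
  calc ∫⁻ x in K, (levelCount (levelSet S lev) B l x : ℝ≥0∞)
      ≤ ∫⁻ x in K, ∑ Q ∈ S with l ≤ lev Q, Q.set.indicator 1 x :=
        lintegral_mono fun x => levelCount_levelSet_le x
    _ = ∑ Q ∈ S with l ≤ lev Q, volume (Q.set ∩ K) := by
        rw [lintegral_finsetSum]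
        · refine Finset.sum_congr rfl fun Q _ => ?_
          rw [lintegral_indicator_one Q.measurableSet_set,
            Measure.restrict_apply Q.measurableSet_set]
        · exact fun Q _ => measurable_one.indicator Q.measurableSet_set
    _ = ∑ Q ∈ T, volume (Q.set ∩ K) := by
        refine (Finset.sum_subset (fun Q hQ => ?_) fun Q hQ hQT => ?_).symm
        · simp only [hT, Finset.mem_filter] at hQ ⊢
          exact ⟨hQ.1, hQ.2.1⟩
        · simp only [hT, Finset.mem_filter] at hQ hQT
          have : ¬ (K ∩ Q.set).Nonempty := fun h => hQT ⟨hQ.1, hQ.2, h⟩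
          rw [inter_comm, Set.not_nonempty_iff_eq_empty.1 this, measure_empty]
    _ ≤ ∑ Q ∈ T, (ENNReal.ofReal η)⁻¹ * volume (E Q) := by
        refine Finset.sum_le_sum fun Q hQ => ?_
        have hQS := (Finset.mem_filter.1 hQ).1
        calc volume (Q.set ∩ K) ≤ volume Q.set := measure_mono inter_subset_left
          _ = (ENNReal.ofReal η)⁻¹ * (ENNReal.ofReal η * volume Q.set) := by
            rw [← mul_assoc, ENNReal.inv_mul_cancel hη0 ofReal_ne_top, one_mul]
          _ ≤ _ := by gcongr; exact (hE Q hQS).2.2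
    _ = (ENNReal.ofReal η)⁻¹ * volume (⋃ Q ∈ T, E Q) := by
        rw [measure_biUnion_finset, Finset.mul_sum]
        · intro Q hQ Q' hQ' hne
          exact hdisj (Finset.mem_filter.1 hQ).1 (Finset.mem_filter.1 hQ').1 hne
        · exact fun Q hQ => (hE Q (Finset.mem_filter.1 hQ).1).2.1
    _ ≤ (ENNReal.ofReal η)⁻¹ * volume P.set := by
        gcongr
        exact iUnion₂_subset fun Q hQ =>
          (hE Q (Finset.mem_filter.1 hQ).1).1.trans (hsub Q hQ)
    _ = _ := by rw [hPvol, ENNReal.div_eq_inv_mul, mul_assoc]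

end Grid

section Weight

/-- The measure `w dx`. -/
def weightMeasure (w : Rd d → ℝ) : Measure (Rd d) :=
  volume.withDensity fun x => ENNReal.ofReal (w x)

lemma weightMeasure_apply (w : Rd d → ℝ) (A : Set (Rd d)) : weightMeasure w A = wMeas w A :=
  withDensity_apply' _ A

variable {w : Rd d → ℝ}

lemma IsWeight.wMeas_ne_top (hw : IsWeight w) (Q : Cube d) : wMeas w Q.set ≠ ∞ := by
  have hsub : Q.set ⊆ Icc Q.corner fun i => Q.corner i + Q.side := fun x hx =>
    ⟨fun i => (hx i).1, fun i => (hx i).2.le⟩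
  have hint : IntegrableOn w Q.set :=
    (hw.1.integrableOn_isCompact isCompact_Icc).mono_set hsub
  refine ne_top_of_le_ne_top hint.2.ne (lintegral_mono fun x => ?_)
  exact Real.ofReal_le_enorm (w x)

lemma IsWeight.wMeas_ne_zero (hw : IsWeight w) (Q : Cube d) : wMeas w Q.set ≠ 0 := by
  intro h
  have hm : AEMeasurable (fun x => ENNReal.ofReal (w x)) (volume.restrict Q.set) :=
    hw.1.aestronglyMeasurable.aemeasurable.ennreal_ofReal.restrict
  have h0 := (lintegral_eq_zero_iff' hm).1 h
  have hpos := ae_restrict_of_ae (s := Q.set) hw.2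
  have hfalse : ∀ᵐ x ∂(volume.restrict Q.set), False := by
    filter_upwards [h0, hpos] with x hx hx'
    simp only [Pi.zero_apply, ENNReal.ofReal_eq_zero] at hx
    linarith
  rw [Filter.eventually_false_iff_eq_bot, ae_eq_bot, Measure.restrict_eq_zero] at hfalse
  exact Q.volume_set_ne_zero hfalse

lemma IsWeight.lintegral_maximal_le (hw : IsWeight w) (Q : Cube d) :
    ∫⁻ x in Q.set, maximal (Q.set.indicator w) x ≤ FW w * wMeas w Q.set := by
  have h : (wMeas w Q.set)⁻¹ * ∫⁻ x in Q.set, maximal (Q.set.indicator w) x ≤ FW w :=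
    le_iSup (fun Q : Cube d =>
      (wMeas w Q.set)⁻¹ * ∫⁻ x in Q.set, maximal (Q.set.indicator w) x) Q
  rw [← ENNReal.div_eq_inv_mul] at h
  exact (ENNReal.div_le_iff (hw.wMeas_ne_zero Q) (hw.wMeas_ne_top Q)).1 h

lemma wMeas_inter_div_le_maximal (w : Rd d → ℝ) {K Q : Cube d} {x : Rd d} (hx : x ∈ Q.set) :
    wMeas w (Q.set ∩ K.set) / volume Q.set ≤ maximal (K.set.indicator w) x := by
  refine le_trans ?_ (le_iSup₂_of_le Q hx le_rfl)
  simp only [avg, eAvg, ofFn, ENNReal.rpow_one, div_one]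
  rw [ENNReal.div_eq_inv_mul]
  gcongr
  rw [wMeas, inter_comm, ← Measure.restrict_restrict K.measurableSet_set,
    ← lintegral_indicator K.measurableSet_set]
  refine lintegral_mono fun y => ?_
  by_cases hy : y ∈ K.set
  · simpa [hy] using ENNReal.ofReal_le_ofReal (le_abs_self (w y))
  · simp [hy]

lemma IsWeight.one_le_FW (hw : IsWeight w) : 1 ≤ FW w := by
  let Q : Cube d := ⟨0, 1, one_pos⟩
  have h : wMeas w Q.set ≤ FW w * wMeas w Q.set := by
    refine le_trans ?_ (hw.lintegral_maximal_le Q)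
    calc wMeas w Q.set = ∫⁻ x in Q.set, wMeas w (Q.set ∩ Q.set) / volume Q.set := by
          rw [setLIntegral_const, inter_self,
            ENNReal.div_mul_cancel Q.volume_set_ne_zero Q.volume_set_ne_top]
      _ ≤ _ := setLIntegral_mono' Q.measurableSet_set fun x hx =>
          wMeas_inter_div_le_maximal w hx
  by_contra! hlt
  have := ENNReal.mul_lt_mul_left (hw.wMeas_ne_zero Q) (hw.wMeas_ne_top Q) hlt
  rw [one_mul] at this
  exact absurd h (not_le.2 this)

/-- Sparse families satisfy a Carleson packing condition with respect to `w`, with constant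
proportional to the Fujii–Wilson constant. -/
lemma IsGridFamily.sum_weightMeasure_le {ρ : ℝ} {S : Finset (Cube d)} {lev : Cube d → ℕ}
    {z : Cube d → Fin d → ℤ} (hS : IsGridFamily ρ S lev z) {η : ℝ} (hη : 0 < η)
    (hsp : IsSparse η (S : Set (Cube d))) (hw : IsWeight w) {m : ℕ} (hm : 0 < m)
    (hηm : 2 * (7 ^ d / ENNReal.ofReal η) ≤ m) (B j : ℕ) (x₀ : Rd d) :
    ∑ l ∈ Finset.Ico j B, weightMeasure w (fiberOf (gridIdx ρ j) x₀ ∩ levelSet S lev l) ≤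
      2 * m * FW w * weightMeasure w (fiberOf (gridIdx ρ j) x₀) := by
  have hgm : ∀ n, Measurable (gridIdx (d := d) ρ n) := measurable_gridIdx ρ
  have hDm : ∀ k, MeasurableSet (levelSet S lev k) := fun k =>
    (hS.saturated_levelSet k).measurableSet (hgm k)
  set C := cellCube hS.pos j x₀
  have hCK : C.set = fiberOf (gridIdx ρ j) x₀ := cellCube_set hS.pos j x₀
  let c : ℕ → (Fin d → ℤ) → ℝ≥0∞ := fun l i =>
    weightMeasure w (gridIdx ρ l ⁻¹' {i} ∩ C.set) / volume (gridIdx (d := d) ρ l ⁻¹' {i})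
  let h : Rd d → ℝ≥0∞ := fun x => ⨆ l, c l (gridIdx ρ l x)
  have hh : Measurable h := Measurable.iSup fun l => (measurable_of_countable (c l)).comp (hgm l)
  have hle : ∀ x, h x ≤ maximal (C.set.indicator w) x := by
    refine fun x => iSup_le fun l => ?_
    have h1 := cellCube_set hS.pos l x
    have := wMeas_inter_div_le_maximal w (K := C) (Q := cellCube hS.pos l x) (x := x)
      (h1 ▸ mem_fiberOf_self _ x)
    rw [h1, ← weightMeasure_apply] at this
    exact this
  refine (sum_measure_inter_le_lintegral hgm (gridIdx_of_succ ρ) (vol := volume) (m := m)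
    hS.saturated_levelSet ?_ j x₀ hh ?_).trans ?_
  · intro l x
    have hcell := cellCube_set hS.pos l x
    refine measure_le_two_mul_of_lintegral_levelCount (measurable_levelCount hDm B l)
      (measurableSet_fiberOf (hgm l) x) ?_ hm hηm (hS.lintegral_levelCount_le hη hsp B l x)
    rw [← hcell]
    exact Cube.volume_set_ne_top _
  · intro l x hjl hx
    have hcell := cellCube_set hS.pos l x
    have hsub : fiberOf (gridIdx ρ l) x ⊆ C.set := by
      rw [hCK, ← fiberOf_eq hx]
      exact fiberOf_subset_of_le (gridIdx_of_succ ρ) hjl x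
    refine ⟨c l (gridIdx ρ l x), ?_, fun y hy => ?_⟩
    · change _ ≤ weightMeasure w (fiberOf (gridIdx ρ l) x ∩ C.set) /
        volume (fiberOf (gridIdx ρ l) x) * _
      rw [inter_eq_self_of_subset_left hsub, ← hcell,
        ENNReal.div_mul_cancel (Cube.volume_set_ne_zero _) (Cube.volume_set_ne_top _)]
    · have hy' : gridIdx ρ l y = gridIdx ρ l x := hy
      rw [← hy']
      exact le_iSup (fun l => c l (gridIdx ρ l y)) l
  · rw [mul_assoc (2 * (m : ℝ≥0∞))]
    gcongr
    rw [weightMeasure_apply, ← hCK]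
    exact (lintegral_mono hle).trans (hw.lintegral_maximal_le C)

/-- Exponential decay of the level count with respect to `w`. -/
lemma IsGridFamily.weightMeasure_levelCount_ge_le {ρ : ℝ} {S : Finset (Cube d)}
    {lev : Cube d → ℕ} {z : Cube d → Fin d → ℤ} (hS : IsGridFamily ρ S lev z) {η : ℝ}
    (hη : 0 < η) (hη1 : η ≤ 1) (hsp : IsSparse η (S : Set (Cube d))) (hw : IsWeight w)
    (hF : FW w ≠ ∞) (B j : ℕ) (x₀ : Rd d) (t : ℝ) :
    weightMeasure w (fiberOf (gridIdx ρ j) x₀ ∩ {x | t ≤ levelCount (levelSet S lev) B j x}) ≤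
      ENNReal.ofReal (2 * Real.exp (-(η / (24 * 7 ^ d * (FW w).toReal) * t))) *
        weightMeasure w (fiberOf (gridIdx ρ j) x₀) := by
  have hgm : ∀ n, Measurable (gridIdx (d := d) ρ n) := measurable_gridIdx ρ
  have hDm : ∀ k, MeasurableSet (levelSet S lev k) := fun k =>
    (hS.saturated_levelSet k).measurableSet (hgm k)
  set F := (FW w).toReal with hFdef
  have hF1 : 1 ≤ F := by
    have := ENNReal.toReal_mono hF hw.one_le_FW
    simpa using this
  have h7 : (1 : ℝ) ≤ 7 ^ d := one_le_pow₀ (by norm_num)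
  set u := η / (24 * 7 ^ d * F) with hu
  have hu0 : 0 < u := by positivity
  have hu1 : u ≤ 1 := by
    rw [hu, div_le_one (by positivity)]
    nlinarith [mul_le_mul h7 hF1 zero_le_one (by positivity)]
  set m := ⌈2 * (7 ^ d / η)⌉₊ with hm
  have hm0 : 0 < m := Nat.ceil_pos.2 (by positivity)
  have hm1 : 2 * (7 ^ d / η) ≤ m := Nat.le_ceil _
  have hm2 : (m : ℝ) ≤ 3 * (7 ^ d / η) := by
    have h1 : (m : ℝ) < 2 * (7 ^ d / η) + 1 := Nat.ceil_lt_add_one (by positivity)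
    have h2 : 1 ≤ 7 ^ d / η := by rw [le_div_iff₀ hη]; linarith
    linarith
  have hηm : 2 * (7 ^ d / ENNReal.ofReal η) ≤ (m : ℝ≥0∞) := by
    have h := ENNReal.ofReal_le_ofReal hm1
    rw [ENNReal.ofReal_mul (by norm_num), ENNReal.ofReal_div_of_pos hη,
      ENNReal.ofReal_pow (by norm_num), ENNReal.ofReal_natCast] at h
    simpa using h
  set s := Real.exp u - 1 with hs
  have hs0 : 0 ≤ s := by
    have := Real.one_le_exp hu0.le
    linarith
  have hs2 : s ≤ 2 * u := by
    have := Real.abs_exp_sub_one_le (x := u) (by rwa [abs_of_pos hu0])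
    rwa [abs_of_pos hu0, ← hs, abs_of_nonneg hs0] at this
  have hsΛ : 2 * (ENNReal.ofReal s * (2 * m * FW w)) ≤ 1 := by
    have hreal : 2 * (s * (2 * m * F)) ≤ 1 := by
      calc 2 * (s * (2 * m * F)) ≤ 2 * (2 * u * (2 * (3 * (7 ^ d / η)) * F)) := by gcongr
        _ = 1 := by rw [hu]; field_simp; norm_num
    have := ENNReal.ofReal_le_ofReal hreal
    rw [ENNReal.ofReal_mul (by norm_num), ENNReal.ofReal_mul hs0,
      ENNReal.ofReal_mul (by positivity), ENNReal.ofReal_mul (by norm_num), hFdef,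
      ENNReal.ofReal_toReal hF, ENNReal.ofReal_natCast] at this
    simpa using this
  have hexp := lintegral_pow_levelCount_le hgm (gridIdx_of_succ ρ) hS.saturated_levelSet hsΛ
    (hS.sum_weightMeasure_le hη hsp hw hm0 hηm B) j x₀
  have h1s : 1 + ENNReal.ofReal s = ENNReal.ofReal (Real.exp u) := by
    rw [← ENNReal.ofReal_one, ← ENNReal.ofReal_add zero_le_one hs0, hs]
    congr 1
    ring
  set K := fiberOf (gridIdx ρ j) x₀
  set G : Set (Rd d) := {x | t ≤ levelCount (levelSet S lev) B j x}
  have hGm : MeasurableSet G :=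
    measurableSet_le measurable_const
      ((measurable_of_countable (fun n : ℕ => (n : ℝ))).comp (measurable_levelCount hDm B j))
  have hKm : MeasurableSet K := measurableSet_fiberOf (hgm j) x₀
  have hmarkov : ENNReal.ofReal (Real.exp (u * t)) * weightMeasure w (K ∩ G) ≤
      2 * weightMeasure w K := by
    refine le_trans ?_ hexp
    rw [← setLIntegral_const]
    refine (setLIntegral_mono' (hKm.inter hGm) fun x hx => ?_).trans
      (lintegral_mono_set inter_subset_left)
    rw [h1s, ← ENNReal.ofReal_pow (Real.exp_pos u).le, ← Real.exp_nat_mul, mul_comm _ u]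
    exact ENNReal.ofReal_le_ofReal (Real.exp_le_exp.2 (mul_le_mul_of_nonneg_left hx.2 hu0.le))
  calc weightMeasure w (K ∩ G)
      = ENNReal.ofReal (Real.exp (-(u * t))) *
          (ENNReal.ofReal (Real.exp (u * t)) * weightMeasure w (K ∩ G)) := by
        rw [← mul_assoc, ← ENNReal.ofReal_mul (Real.exp_pos _).le, ← Real.exp_add]
        simp
    _ ≤ ENNReal.ofReal (Real.exp (-(u * t))) * (2 * weightMeasure w K) := by gcongr
    _ = _ := by
        rw [ENNReal.ofReal_mul (by norm_num), ENNReal.ofReal_ofNat]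
        ring

end Weight

section Family

/-- A finite subfamily of a dyadic grid is a grid family. -/
lemma IsDyadicGrid.exists_isGridFamily {D : Set (Cube d)} (hD : IsDyadicGrid D)
    {S : Finset (Cube d)} (hSD : (S : Set (Cube d)) ⊆ D) :
    ∃ ρ lev z, IsGridFamily ρ S lev z := by
  classical
  obtain ⟨α, hα, rfl⟩ := hD
  have hp : ∀ i, ∃ p : ℤ, α i = p / 3 := by
    intro i
    rcases hα i with h | h | h
    · exact ⟨0, by simp [h]⟩
    · exact ⟨1, by simp [h]⟩
    · exact ⟨2, by simp [h]⟩
  choose p hp using hp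
  have hS : ∀ Q ∈ S, ∃ (j : ℤ) (k : Fin d → ℤ),
      Q.side = (2:ℝ) ^ (-j) ∧ ∀ i, Q.corner i = (2:ℝ) ^ (-j) * (α i + k i) :=
    fun Q hQ => hSD hQ
  choose! j k hjk using hS
  obtain ⟨J, hJ⟩ : ∃ J : ℤ, ∀ Q ∈ S, J ≤ j Q := by
    obtain ⟨J, hJ⟩ := (S.image j).finite_toSet.bddBelow
    exact ⟨J, fun Q hQ => hJ (by simpa using ⟨Q, hQ, rfl⟩)⟩
  have hpow : ∀ Q ∈ S, (3 * 2 ^ J * 2 ^ (j Q - J).toNat : ℝ) = 3 * 2 ^ j Q := by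
    intro Q hQ
    rw [mul_assoc, ← zpow_natCast, ← zpow_add₀ two_ne_zero,
      Int.toNat_of_nonneg (sub_nonneg.2 (hJ Q hQ)), add_sub_cancel]
  refine ⟨3 * 2 ^ J, fun Q => (j Q - J).toNat, fun Q i => p i + 3 * k Q i, by positivity, ?_, ?_, ?_⟩
  · intro Q hQ
    rw [hpow Q hQ, (hjk Q hQ).1, zpow_neg]
    field_simp
  · intro Q hQ i
    rw [hpow Q hQ, (hjk Q hQ).2, hp, zpow_neg]
    push_cast
    field_simp
  · intro Q _ Q' _ i
    simp [Int.ModEq, Int.add_mul_emod_self_left]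

lemma ofReal_lt_AFam_iff {S : Finset (Cube d)} {a : Cube d → ℝ} (ha : ∀ Q ∈ S, 0 < a Q)
    {q : ℝ≥0∞} (hq : 0 < q) (hq' : q ≠ ∞) {c : ℝ} (hc : 0 < c) (x : Rd d) :
    ENNReal.ofReal c < AFam (S : Set (Cube d)) a q x ↔
      c ^ q.toReal < ∑ Q ∈ S, Q.set.indicator (fun _ => a Q ^ q.toReal) x := by
  have hp : 0 < q.toReal := ENNReal.toReal_pos hq.ne' hq'
  have hsum : ∑' Q : (S : Set (Cube d)),
      (Q.1).set.indicator (fun _ => ENNReal.ofReal (a Q.1) ^ q.toReal) x =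
      ENNReal.ofReal (∑ Q ∈ S, Q.set.indicator (fun _ => a Q ^ q.toReal) x) := by
    rw [Finset.tsum_subtype' S fun Q : Cube d =>
      Q.set.indicator (fun _ => ENNReal.ofReal (a Q) ^ q.toReal) x, ENNReal.ofReal_sum_of_nonneg]
    · refine Finset.sum_congr rfl fun Q hQ => ?_
      by_cases hx : x ∈ Q.set
      · simp [hx, ENNReal.ofReal_rpow_of_pos (ha Q hQ)]
      · simp [hx]
    · exact fun Q hQ => indicator_nonneg (fun _ _ => (Real.rpow_pos_of_pos (ha Q hQ) _).le) x
  rw [AFam, if_neg hq', hsum, one_div, ENNReal.lt_rpow_inv_iff hp, ENNReal.ofReal_rpow_of_pos hc,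
    ENNReal.ofReal_lt_ofReal_iff_of_nonneg (Real.rpow_pos_of_pos hc _).le]

/-- Hölder's inequality on finite sets. -/
lemma sum_rpow_le_of_sum_rpow_le {ι : Type*} {T : Finset ι} {a : ι → ℝ} (ha : ∀ i ∈ T, 0 < a i)
    {p r b : ℝ} (hp : 0 < p) (hpr : p < r) (hb : 0 ≤ b) (h : ∑ i ∈ T, a i ^ r ≤ b ^ r) :
    ∑ i ∈ T, a i ^ p ≤ b ^ p * (T.card : ℝ) ^ (1 - p / r) := by
  have hr : 0 < r := hp.trans hpr
  have hs : 1 < r / p := (one_lt_div hp).2 hpr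
  have hconj := Real.HolderConjugate.conjExponent hs
  have hH := Real.inner_le_Lp_mul_Lq_of_nonneg T hconj (f := fun i => a i ^ p) (g := fun _ => 1)
    (fun i hi => (Real.rpow_pos_of_pos (ha i hi) _).le) (fun _ _ => zero_le_one)
  have hexp : 1 / Real.conjExponent (r / p) = 1 - p / r := by
    have := hconj.inv_add_inv_eq_one
    rw [inv_div] at this
    rw [one_div]
    linarith
  rw [hexp] at hH
  simp only [mul_one, Real.one_rpow, Finset.sum_const, nsmul_eq_mul, one_div_div] at hH
  refine hH.trans ?_
  have hsum : ∑ i ∈ T, (a i ^ p) ^ (r / p) = ∑ i ∈ T, a i ^ r := by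
    refine Finset.sum_congr rfl fun i hi => ?_
    rw [← Real.rpow_mul (ha i hi).le, mul_div_cancel₀ _ hp.ne']
  rw [hsum]
  gcongr
  calc (∑ i ∈ T, a i ^ r) ^ (p / r) ≤ (b ^ r) ^ (p / r) := by
        refine Real.rpow_le_rpow ?_ h (by positivity)
        exact Finset.sum_nonneg fun i hi => (Real.rpow_pos_of_pos (ha i hi) _).le
    _ = b ^ p := by rw [← Real.rpow_mul hb, mul_div_cancel₀ _ hr.ne']

/-- A bound on `A^r_S` controls `ℓ^q` sums over subfamilies through their cardinality. -/
lemma sum_rpow_le_of_AFam_le {S : Finset (Cube d)} {a : Cube d → ℝ} (ha : ∀ Q ∈ S, 0 < a Q)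
    {q r : ℝ≥0∞} (hq : 0 < q) (hqr : q < r) {b : ℝ} (hb : 0 ≤ b) {x : Rd d}
    (h : AFam (S : Set (Cube d)) a r x ≤ ENNReal.ofReal b) {T : Finset (Cube d)}
    (hT : ∀ Q ∈ T, Q ∈ S ∧ x ∈ Q.set) :
    ∑ Q ∈ T, a Q ^ q.toReal ≤
      b ^ q.toReal * (T.card : ℝ) ^ (1 - q.toReal * (r⁻¹).toReal) := by
  have hq' : q ≠ ∞ := hqr.ne_top
  have hp : 0 < q.toReal := ENNReal.toReal_pos hq.ne' hq'
  have haT : ∀ Q ∈ T, 0 < a Q := fun Q hQ => ha Q (hT Q hQ).1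
  rcases eq_or_ne r ∞ with rfl | hr
  · have hle : ∀ Q ∈ T, a Q ^ q.toReal ≤ b ^ q.toReal := by
      intro Q hQ
      refine Real.rpow_le_rpow (haT Q hQ).le ?_ hp.le
      rw [AFam, if_pos rfl] at h
      have h1 : ENNReal.ofReal (a Q) ≤ ENNReal.ofReal b :=
        (le_iSup₂_of_le (f := fun (Q : (S : Set (Cube d))) (_ : x ∈ (Q.1).set) =>
          ENNReal.ofReal (a Q.1)) ⟨Q, (hT Q hQ).1⟩ (hT Q hQ).2 le_rfl).trans h
      exact (ENNReal.ofReal_le_ofReal_iff hb).1 h1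
    have := Finset.sum_le_sum hle
    simpa [mul_comm] using this
  · have hpr : q.toReal < r.toReal := (ENNReal.toReal_lt_toReal hq' hr).2 hqr
    have hr0 : 0 < r.toReal := hp.trans hpr
    rw [ENNReal.toReal_inv, ← div_eq_mul_inv]
    refine sum_rpow_le_of_sum_rpow_le haT hp hpr hb ?_
    have hmono : ∑ Q ∈ T, a Q ^ r.toReal ≤
        ∑ Q ∈ S, Q.set.indicator (fun _ => a Q ^ r.toReal) x := by
      calc ∑ Q ∈ T, a Q ^ r.toReal
          = ∑ Q ∈ T, Q.set.indicator (fun _ => a Q ^ r.toReal) x :=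
            Finset.sum_congr rfl fun Q hQ => by simp [(hT Q hQ).2]
        _ ≤ _ := Finset.sum_le_sum_of_subset_of_nonneg (fun Q hQ => (hT Q hQ).1)
            fun Q hQ _ => indicator_nonneg
              (fun _ _ => (Real.rpow_pos_of_pos (ha Q hQ) _).le) x
    refine hmono.trans (le_of_forall_gt_imp_ge_of_dense fun c hc => ?_)
    by_contra! hlt
    have hc0 : 0 < c := (Real.rpow_nonneg hb _).trans_lt hc
    have h2 : ENNReal.ofReal (c ^ (1 / r.toReal)) < AFam (S : Set (Cube d)) a r x := by
      rw [ofReal_lt_AFam_iff ha (hq.trans hqr) hr (Real.rpow_pos_of_pos hc0 _),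
        ← Real.rpow_mul hc0.le, one_div_mul_cancel hr0.ne', Real.rpow_one]
      exact hlt
    have h3 := h2.trans_le h
    have h4 := (ENNReal.ofReal_lt_ofReal_iff_of_nonneg (Real.rpow_nonneg hc0.le _)).1 h3
    have h5 := Real.rpow_lt_rpow (Real.rpow_nonneg hc0.le _) h4 hr0
    rw [← Real.rpow_mul hc0.le, one_div_mul_cancel hr0.ne', Real.rpow_one] at h5
    exact absurd h5 (not_lt.2 hc.le)

end Family

/-- The good-`λ` inequality (Theorem on good-lambda). -/
theorem stmt9 (d : ℕ) (hd : 1 ≤ d)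
    (q r : ℝ≥0∞) (hq : 0 < q) (hqr : q < r) :
    ∃ δ c : ℝ, 0 < δ ∧ 0 < c ∧
      ∀ D : Set (Cube d), IsDyadicGrid D →
      ∀ w : Rd d → ℝ, IsWeight w → FW w ≠ ∞ →
      ∀ η : ℝ, 0 < η → η ≤ 1 →
      ∀ S : Set (Cube d), S ⊆ D → S.Finite → IsSparse η S →
      ∀ a : Cube d → ℝ, (∀ Q ∈ S, 0 < a Q) →
      ∀ lam gam : ℝ, 0 < lam → 0 < gam →
        wMeas w {x | ENNReal.ofReal (2 * lam) < AFam S a q x ∧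
            AFam S a r x ≤
              ENNReal.ofReal (gam ^ ((q⁻¹).toReal - (r⁻¹).toReal) * lam)} ≤
          ENNReal.ofReal (c * Real.exp (-(δ * η) / (gam * (FW w).toReal))) *
            wMeas w {x | ENNReal.ofReal lam < AFam S a q x} := by
  have hq' : q ≠ ∞ := hqr.ne_top
  have hp : 0 < q.toReal := ENNReal.toReal_pos hq.ne' hq'
  set p := q.toReal with hpdef
  set θ := 1 - p * (r⁻¹).toReal with hθdef
  have hθ : 0 < θ := by
    rcases eq_or_ne r ∞ with rfl | hr
    · simp [hθdef]
    · have hpr : p < r.toReal := (ENNReal.toReal_lt_toReal hq' hr).2 hqr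
      rw [hθdef, ENNReal.toReal_inv, ← div_eq_mul_inv, sub_pos, div_lt_one (hp.trans hpr)]
      exact hpr
  have h2p : 0 < (2 : ℝ) ^ p - 1 := sub_pos.2 (Real.one_lt_rpow one_lt_two hp)
  set κ := ((2 : ℝ) ^ p - 1) ^ (1 / θ) with hκ
  have hκ0 : 0 < κ := Real.rpow_pos_of_pos h2p _
  refine ⟨κ / (24 * 7 ^ d), 2, by positivity, two_pos, ?_⟩
  intro D hD w hw hF η hη hη1 S hSD hSfin hsp a ha lam gam hlam hgam
  lift S to Finset (Cube d) using hSfin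
  obtain ⟨ρ, lev, z, hS⟩ := hD.exists_isGridFamily hSD
  have ha' : ∀ Q ∈ S, 0 < a Q := fun Q hQ => ha Q hQ
  obtain ⟨B, hB⟩ : ∃ B, ∀ Q ∈ S, lev Q < B :=
    ⟨S.sup lev + 1, fun Q hQ => Nat.lt_succ_of_le (Finset.le_sup hQ)⟩
  have hnn : ∀ Q ∈ S, ∀ x, 0 ≤ Q.set.indicator (fun _ => a Q ^ p) x := fun Q hQ x =>
    indicator_nonneg (fun _ _ => (Real.rpow_pos_of_pos (ha' Q hQ) _).le) x
  let V : ℕ → Set (Rd d) := fun k =>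
    {x | lam ^ p < ∑ Q ∈ S with lev Q ≤ k, Q.set.indicator (fun _ => a Q ^ p) x}
  have hV : ∀ k, FiberSaturated (gridIdx ρ k) (V k) := by
    intro k x y hxy hx
    have heq : ∀ Q ∈ S.filter (fun Q => lev Q ≤ k), Q.set.indicator (fun _ => a Q ^ p) x =
        Q.set.indicator (fun _ => a Q ^ p) y := by
      intro Q hQ
      obtain ⟨hQS, hk⟩ := Finset.mem_filter.1 hQ
      have hxy' : gridIdx ρ (lev Q) x = gridIdx ρ (lev Q) y :=
        fiberOf_subset_of_le (gridIdx_of_succ ρ) hk y hxy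
      have hiff : x ∈ Q.set ↔ y ∈ Q.set :=
        ⟨hS.saturated_set hQS x y hxy', hS.saturated_set hQS y x hxy'.symm⟩
      by_cases hx' : x ∈ Q.set
      · simp [hx', hiff.1 hx']
      · rw [indicator_of_notMem hx', indicator_of_notMem (hiff.not.1 hx')]
    change lam ^ p < _ at hx
    rwa [Finset.sum_congr rfl heq] at hx
  have hU : {x | ENNReal.ofReal lam < AFam (S : Set (Cube d)) a q x} = ⋃ k, V k := by
    ext x
    rw [mem_ofPred_eq, ofReal_lt_AFam_iff ha' hq hq' hlam, mem_iUnion]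
    constructor
    · intro h
      refine ⟨B, ?_⟩
      change lam ^ p < _
      rwa [Finset.filter_true_of_mem fun Q hQ => (hB Q hQ).le]
    · rintro ⟨k, hk⟩
      exact lt_of_lt_of_le hk (Finset.sum_le_sum_of_subset_of_nonneg (Finset.filter_subset _ _)
        fun Q hQ _ => hnn Q hQ x)
  set A := {x | ENNReal.ofReal (2 * lam) < AFam (S : Set (Cube d)) a q x ∧
    AFam (S : Set (Cube d)) a r x ≤
      ENNReal.ofReal (gam ^ ((q⁻¹).toReal - (r⁻¹).toReal) * lam)} with hAdef
  have hAU : A ⊆ ⋃ k, V k := by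
    rw [← hU]
    exact fun x hx => (ENNReal.ofReal_le_ofReal (by linarith)).trans_lt hx.1
  rw [hU, ← weightMeasure_apply, ← weightMeasure_apply]
  refine measure_le_mul_measure_iUnion (measurable_gridIdx ρ) (gridIdx_of_succ ρ) hV hAU
    (G := fun k => {x | κ / gam ≤ levelCount (levelSet S lev) B k x}) ?_ ?_
  · intro k x
    have hexp : -(κ / (24 * 7 ^ d) * η) / (gam * (FW w).toReal) =
        -(η / (24 * 7 ^ d * (FW w).toReal) * (κ / gam)) := by
      rw [neg_div, div_mul_eq_mul_div, div_div, div_mul_div_comm]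
      congr 2 <;> ring
    rw [hexp]
    exact hS.weightMeasure_levelCount_ge_le hη hη1 hsp hw hF B k x _
  · intro k x hxA hxk hxlt
    classical
    set T := S.filter fun Q => k ≤ lev Q ∧ x ∈ Q.set with hTdef
    have hTmem : ∀ Q ∈ T, Q ∈ S ∧ k ≤ lev Q ∧ x ∈ Q.set := fun Q hQ => Finset.mem_filter.1 hQ
    have hcard := hS.card_le_levelCount hB x hTmem
    have htot := (ofReal_lt_AFam_iff ha' hq hq' (by positivity) x).1 hxA.1
    rw [Real.mul_rpow two_pos.le hlam.le] at htot
    have hlow : ∑ Q ∈ S with lev Q < k, Q.set.indicator (fun _ => a Q ^ p) x ≤ lam ^ p := by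
      rcases k with - | k
      · simpa using Real.rpow_nonneg hlam.le p
      · have := hxlt k (Nat.lt_succ_self k)
        simp only [V, mem_ofPred_eq, not_lt] at this
        simpa only [Nat.lt_succ_iff] using this
    have hhigh : ∑ Q ∈ S with ¬ lev Q < k, Q.set.indicator (fun _ => a Q ^ p) x =
        ∑ Q ∈ T, a Q ^ p := by
      simp only [hTdef, not_lt, Finset.sum_filter, indicator_apply, ite_and]
    have hsplit := Finset.sum_filter_add_sum_filter_not S (fun Q => lev Q < k)
      fun Q => Q.set.indicator (fun _ => a Q ^ p) x
    have hHolder := sum_rpow_le_of_AFam_le ha' hq hqr (by positivity) hxA.2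
      (T := T) fun Q hQ => ⟨(hTmem Q hQ).1, (hTmem Q hQ).2.2⟩
    have hpow : (gam ^ ((q⁻¹).toReal - (r⁻¹).toReal) * lam) ^ p = gam ^ θ * lam ^ p := by
      rw [Real.mul_rpow (by positivity) hlam.le, ← Real.rpow_mul hgam.le]
      congr 2
      rw [ENNReal.toReal_inv, ← hpdef, hθdef, sub_mul, inv_mul_cancel₀ hp.ne']
      ring
    rw [← hpdef, hpow, ← hθdef] at hHolder
    have hlamp : 0 < lam ^ p := Real.rpow_pos_of_pos hlam p
    have hmain : (2 : ℝ) ^ p - 1 ≤ (gam * T.card) ^ θ := by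
      rw [Real.mul_rpow hgam.le (Nat.cast_nonneg _)]
      refine le_of_mul_le_mul_right ?_ hlamp
      calc ((2 : ℝ) ^ p - 1) * lam ^ p ≤ ∑ Q ∈ T, a Q ^ p := by linarith
        _ ≤ gam ^ θ * lam ^ p * (T.card : ℝ) ^ θ := hHolder
        _ = gam ^ θ * (T.card : ℝ) ^ θ * lam ^ p := by ring
    have hκle : κ ≤ gam * T.card := by
      have := Real.rpow_le_rpow h2p.le hmain (one_div_pos.2 hθ).le
      rwa [← Real.rpow_mul (by positivity), mul_one_div_cancel hθ.ne', Real.rpow_one] at this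
    change κ / gam ≤ _
    rw [div_le_iff₀' hgam]
    refine hκle.trans ?_
    gcongr

end Paper
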